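/- Let λ ∈ ℂ and let a(λ) be the symmetric tensor of the ternary cubic f(x,y,z) = zy² − x(x−z)(x−λz) (obtained by symmetrizing its coefficients). Then, with J = J(a(λ)) and K = K(a(λ)), one has the identity 27·λ²·(λ−1)²·J³ = 4·(λ²−λ+1)³·(J³ − 6K²) for all λ ∈ ℂ; in particular for λ ≠ 0, 1 the ratio J³/(J³−6K²) equals (4/27)·(λ²−λ+1)³/(λ²(λ−1)²), the j-invariant (in Saito's normalisation) of the elliptic curve {f = 0} in ℂP². -/

import Mathlib

noncomputable section
open Finset

/-- The totally antisymmetric symbol on three indices with `ε^{123} = 1`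
(indices `0,1,2` in `Fin 3`). -/
def eps3 : Fin 3 → Fin 3 → Fin 3 → ℂ := fun i j k =>
  if (i, j, k) = (0, 1, 2) ∨ (i, j, k) = (1, 2, 0) ∨ (i, j, k) = (2, 0, 1) then 1
  else if (i, j, k) = (0, 2, 1) ∨ (i, j, k) = (2, 1, 0) ∨ (i, j, k) = (1, 0, 2) then -1
  else 0

/-- The partial contraction `b_{ij}^{kl} = Σ a_{pqi} a_{rsj} ε^{prk} ε^{qsl}`. -/
def bT (a : Fin 3 → Fin 3 → Fin 3 → ℂ) (i j k l : Fin 3) : ℂ :=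
  ∑ p : Fin 3, ∑ q : Fin 3, ∑ r : Fin 3, ∑ s : Fin 3,
    a p q i * a r s j * eps3 p r k * eps3 q s l

/-- The partial contraction `c_{ijk} = Σ b_{ij}^{pq} a_{pqk}`. -/
def cT (a : Fin 3 → Fin 3 → Fin 3 → ℂ) (i j k : Fin 3) : ℂ :=
  ∑ p : Fin 3, ∑ q : Fin 3, bT a i j p q * a p q k

/-- The partial contraction `d^{ijk} = Σ b_{pq}^{ir} a_{rst} ε^{ptk} ε^{qjs}`. -/
def dT (a : Fin 3 → Fin 3 → Fin 3 → ℂ) (i j k : Fin 3) : ℂ :=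
  ∑ p : Fin 3, ∑ q : Fin 3, ∑ r : Fin 3, ∑ s : Fin 3, ∑ t : Fin 3,
    bT a p q i r * a r s t * eps3 p t k * eps3 q j s

/-- The degree-4 invariant `J = Σ b_{ij}^{kl} b_{kl}^{ij}` of a ternary cubic. -/
def JT (a : Fin 3 → Fin 3 → Fin 3 → ℂ) : ℂ :=
  ∑ i : Fin 3, ∑ j : Fin 3, ∑ k : Fin 3, ∑ l : Fin 3, bT a i j k l * bT a k l i j

/-- The degree-6 invariant `K = Σ c_{ijk} d^{ijk}` of a ternary cubic. -/
def KT (a : Fin 3 → Fin 3 → Fin 3 → ℂ) : ℂ :=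
  ∑ i : Fin 3, ∑ j : Fin 3, ∑ k : Fin 3, cT a i j k * dT a i j k

/-- The symmetric tensor of the ternary cubic
`f(x,y,z) = zy² − x(x−z)(x−λz) = −x³ + (1+λ)x²z − λxz² + y²z`,
with `x,y,z` corresponding to the indices `0,1,2`. -/
def aLam (l : ℂ) : Fin 3 → Fin 3 → Fin 3 → ℂ := fun i j k =>
  if (i, j, k) = (0, 0, 0) then -1
  else if (i, j, k) = (1, 1, 2) ∨ (i, j, k) = (1, 2, 1) ∨ (i, j, k) = (2, 1, 1) then 1 / 3
  else if (i, j, k) = (0, 0, 2) ∨ (i, j, k) = (0, 2, 0) ∨ (i, j, k) = (2, 0, 0) then (1 + l) / 3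
  else if (i, j, k) = (0, 2, 2) ∨ (i, j, k) = (2, 0, 2) ∨ (i, j, k) = (2, 2, 0) then -l / 3
  else 0

/-- Contracting the first two indices of `ε` antisymmetrizes over the complement of the third. -/
lemma sum_mul_eps3 (g : Fin 3 → Fin 3 → ℂ) (k : Fin 3) :
    ∑ p, ∑ r, g p r * eps3 p r k = g (k + 1) (k + 2) - g (k + 2) (k + 1) := by
  fin_cases k <;> simp [Fin.sum_univ_three, eps3] <;> ring

lemma sum_mul_eps3_middle (g : Fin 3 → Fin 3 → ℂ) (j : Fin 3) :
    ∑ q, ∑ s, g q s * eps3 q j s = g (j + 2) (j + 1) - g (j + 1) (j + 2) := by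
  fin_cases j <;> simp [Fin.sum_univ_three, eps3] <;> ring

lemma bT_eq (a : Fin 3 → Fin 3 → Fin 3 → ℂ) (i j k l : Fin 3) :
    bT a i j k l =
      a (k + 1) (l + 1) i * a (k + 2) (l + 2) j - a (k + 1) (l + 2) i * a (k + 2) (l + 1) j
      - a (k + 2) (l + 1) i * a (k + 1) (l + 2) j
      + a (k + 2) (l + 2) i * a (k + 1) (l + 1) j := by
  have h : bT a i j k l =
      ∑ p, ∑ r, (∑ q, ∑ s, a p q i * a r s j * eps3 q s l) * eps3 p r k := by
    unfold bT
    refine Finset.sum_congr rfl fun p _ => ?_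
    rw [Finset.sum_comm]
    refine Finset.sum_congr rfl fun r _ => ?_
    simp only [Finset.sum_mul]
    exact Finset.sum_congr rfl fun q _ => Finset.sum_congr rfl fun s _ => by ring
  rw [h, sum_mul_eps3, sum_mul_eps3 (fun q s => a (k + 1) q i * a (k + 2) s j),
    sum_mul_eps3 (fun q s => a (k + 2) q i * a (k + 1) s j)]
  ring

lemma dT_eq (a : Fin 3 → Fin 3 → Fin 3 → ℂ) (i j k : Fin 3) :
    dT a i j k = ∑ r,
      (bT a (k + 1) (j + 2) i r * a r (j + 1) (k + 2)
      - bT a (k + 1) (j + 1) i r * a r (j + 2) (k + 2)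
      - bT a (k + 2) (j + 2) i r * a r (j + 1) (k + 1)
      + bT a (k + 2) (j + 1) i r * a r (j + 2) (k + 1)) := by
  have h : dT a i j k =
      ∑ r, ∑ p, ∑ t, (∑ q, ∑ s, bT a p q i r * a r s t * eps3 q j s) * eps3 p t k := by
    unfold dT
    simp only [Finset.sum_mul]
    conv_lhs => enter [2, p]; rw [Finset.sum_comm]
    rw [Finset.sum_comm]
    refine Finset.sum_congr rfl fun r _ => Finset.sum_congr rfl fun p _ => ?_
    conv_rhs => rw [Finset.sum_comm]
    refine Finset.sum_congr rfl fun q _ => ?_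
    rw [Finset.sum_comm]
    exact Finset.sum_congr rfl fun t _ => Finset.sum_congr rfl fun s _ => by ring
  rw [h]
  refine Finset.sum_congr rfl fun r _ => ?_
  rw [sum_mul_eps3, sum_mul_eps3_middle (fun q s => bT a (k + 1) q i r * a r s (k + 2)),
    sum_mul_eps3_middle (fun q s => bT a (k + 2) q i r * a r s (k + 1))]
  ring

/-- The values of `aLam l`: the `i`-th matrix is that of the quadratic form `∂ᵢf / 3`. -/
def aMat (l : ℂ) : Fin 3 → Matrix (Fin 3) (Fin 3) ℂ
  | 0 => !![-1, 0, (1 + l) / 3; 0, 0, 0; (1 + l) / 3, 0, -l / 3]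
  | 1 => !![0, 0, 0; 0, 0, 1 / 3; 0, 1 / 3, 0]
  | 2 => !![(1 + l) / 3, 0, -l / 3; 0, 1 / 3, 0; -l / 3, 0, 0]

/-- The values of `b_{ij}^{kl}` on `aLam l`: the `(i, j)` entry is the matrix in `(k, l)`. -/
def bMat (l : ℂ) : Fin 3 → Fin 3 → Matrix (Fin 3) (Fin 3) ℂ
  | 0, 0 => !![0, 0, 0; 0, -2 / 9 * (l ^ 2 - l + 1), 0; 0, 0, 0]
  | 0, 1 => !![0, (l + 1) / 9, 0; (l + 1) / 9, 0, 1 / 3; 0, 1 / 3, 0]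
  | 0, 2 => !![-l / 9, 0, -(l + 1) / 9; 0, l * (l + 1) / 9, 0; -(l + 1) / 9, 0, -1 / 3]
  | 1, 0 => !![0, (l + 1) / 9, 0; (l + 1) / 9, 0, 1 / 3; 0, 1 / 3, 0]
  | 1, 1 => !![-2 / 9, 0, 0; 0, 0, 0; 0, 0, 0]
  | 1, 2 => !![0, -l / 9, 0; -l / 9, 0, -(l + 1) / 9; 0, -(l + 1) / 9, 0]
  | 2, 0 => !![-l / 9, 0, -(l + 1) / 9; 0, l * (l + 1) / 9, 0; -(l + 1) / 9, 0, -1 / 3]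
  | 2, 1 => !![0, -l / 9, 0; -l / 9, 0, -(l + 1) / 9; 0, -(l + 1) / 9, 0]
  | 2, 2 => !![0, 0, 2 / 9 * l; 0, -2 / 9 * l ^ 2, 0; 2 / 9 * l, 0, 2 / 9 * (l + 1)]

lemma aLam_eq (l : ℂ) (i j k : Fin 3) : aLam l i j k = aMat l i j k := by
  fin_cases i <;> fin_cases j <;> fin_cases k <;> simp [aLam, aMat]

lemma bT_aLam (l : ℂ) (i j k m : Fin 3) : bT (aLam l) i j k m = bMat l i j k m := by
  simp only [bT_eq, aLam_eq]
  fin_cases i <;> fin_cases j <;> fin_cases k <;> fin_cases m <;>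
    simp [aMat, bMat] <;> ring

lemma JT_aLam (l : ℂ) : JT (aLam l) = 8 / 27 * (l ^ 2 - l + 1) := by
  simp only [JT, bT_aLam, Fin.sum_univ_three]
  simp [bMat]
  ring

lemma KT_aLam (l : ℂ) :
    KT (aLam l) = 8 / 243 * ((l + 1) * (l - 2) * (2 * l - 1)) := by
  simp only [KT, cT, dT_eq, bT_aLam, aLam_eq, Fin.sum_univ_three]
  simp [bMat, aMat]
  ring

/-- For the cubic `zy² − x(x−z)(x−λz)` one has
`27λ²(λ−1)²J³ = 4(λ²−λ+1)³(J³ − 6K²)`; in particular for `λ ≠ 0, 1` the ratio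
`J³/(J³−6K²)` equals the `j`-invariant `(4/27)(λ²−λ+1)³/(λ²(λ−1)²)`. -/
theorem statement4 (l : ℂ) :
    27 * l ^ 2 * (l - 1) ^ 2 * JT (aLam l) ^ 3
        = 4 * (l ^ 2 - l + 1) ^ 3 * (JT (aLam l) ^ 3 - 6 * KT (aLam l) ^ 2)
      ∧ (l ≠ 0 → l ≠ 1 →
          JT (aLam l) ^ 3 / (JT (aLam l) ^ 3 - 6 * KT (aLam l) ^ 2)
            = 4 / 27 * (l ^ 2 - l + 1) ^ 3 / (l ^ 2 * (l - 1) ^ 2)) := by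
  have hD : JT (aLam l) ^ 3 - 6 * KT (aLam l) ^ 2 = 128 / 729 * (l ^ 2 * (l - 1) ^ 2) := by
    rw [JT_aLam, KT_aLam]
    ring
  rw [hD, JT_aLam]
  refine ⟨by ring, fun h0 h1 => ?_⟩
  have h1' : l - 1 ≠ 0 := sub_ne_zero.mpr h1
  field_simp
  ring
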